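/- (Main theorem, expected degree, first case.) For all N ≥ 1, the expected degree satisfies E_{μ_{N,0}}[a] = ( 2(N−1)m(m+2) + (N−1)(N−2)(m+n)(m+n+2) ) / ( 12(m+n+1) ) + ⌊(N−1)/2⌋·(m+n)/2 + m/2. -/

import Mathlib

open Finsupp Filter

noncomputable section

/-- Signed-sum convention: `signedSum c k = Σ_{i=0}^{k} c i`, which is the ordinary sum for
`k ≥ 0`, is `0` for `k = -1`, and equals `-(c (-1) + c (-2) + ⋯ + c (k+1))` for `k ≤ -2`. -/
def signedSum {M : Type*} [AddCommGroup M] (c : ℤ → M) (k : ℤ) : M :=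
  (∑ i ∈ Finset.range (k + 1).toNat, c i) -
    ∑ i ∈ Finset.range (-(k + 1)).toNat, c (-((i : ℤ) + 1))

/-- The Demazure operator `D₀` (relative to `Λ = mΛ₀ + nΛ₁`):
`D₀ δ_{(a,b)} = Σ_{i=0}^{m - 2(a-b)} δ_{(a+i,b)}`, extended ℤ-linearly. -/
def D0 (m : ℕ) (μ : ℤ × ℤ →₀ ℤ) : ℤ × ℤ →₀ ℤ :=
  μ.sum fun p c =>
    c • signedSum (fun i => Finsupp.single (p.1 + i, p.2) (1 : ℤ)) ((m : ℤ) - 2 * (p.1 - p.2))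

/-- The Demazure operator `D₁` (relative to `Λ = mΛ₀ + nΛ₁`):
`D₁ δ_{(a,b)} = Σ_{i=0}^{n + 2(a-b)} δ_{(a,b+i)}`, extended ℤ-linearly. -/
def D1 (n : ℕ) (μ : ℤ × ℤ →₀ ℤ) : ℤ × ℤ →₀ ℤ :=
  μ.sum fun p c =>
    c • signedSum (fun i => Finsupp.single (p.1, p.2 + i) (1 : ℤ)) ((n : ℤ) + 2 * (p.1 - p.2))

/-- Total mass `μ(Γ)` of a finitely supported function on `ℤ × ℤ`. -/
def mass (μ : ℤ × ℤ →₀ ℤ) : ℤ := μ.sum fun _ c => c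

/-- Expected value `E_ν[f] = (1/ν(Γ)) Σ ν(a,b) f(a,b)`. -/
def expVal (ν : ℤ × ℤ →₀ ℤ) (f : ℤ × ℤ → ℚ) : ℚ :=
  (mass ν : ℚ)⁻¹ * ν.sum fun p c => (c : ℚ) * f p

/-- Covariance `Cov_ν(f,g) = E_ν[f·g] - E_ν[f]·E_ν[g]`. -/
def cov (ν : ℤ × ℤ →₀ ℤ) (f g : ℤ × ℤ → ℚ) : ℚ :=
  expVal ν (fun p => f p * g p) - expVal ν f * expVal ν g

/-- Variance `Var_ν(f) = Cov_ν(f,f)`. -/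
def var (ν : ℤ × ℤ →₀ ℤ) (f : ℤ × ℤ → ℚ) : ℚ := cov ν f f

/-- The coordinate function `a` (the degree). -/
def fa : ℤ × ℤ → ℚ := fun p => (p.1 : ℚ)

/-- The coordinate function `b`. -/
def fb : ℤ × ℤ → ℚ := fun p => (p.2 : ℚ)

/-- The finite-weight coordinate `a - b`. -/
def fab : ℤ × ℤ → ℚ := fun p => (p.1 : ℚ) - (p.2 : ℚ)

/-- `μ_{N,0}`: start from `δ_{(0,0)}`, apply `D₀` at odd steps and `D₁` at even steps. -/
def mu0 (m n : ℕ) : ℕ → (ℤ × ℤ →₀ ℤ)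
  | 0 => Finsupp.single (0, 0) 1
  | N + 1 => if N % 2 = 0 then D0 m (mu0 m n N) else D1 n (mu0 m n N)

/-- `μ_{N,1}`: start from `δ_{(0,0)}`, apply `D₁` at odd steps and `D₀` at even steps. -/
def mu1 (m n : ℕ) : ℕ → (ℤ × ℤ →₀ ℤ)
  | 0 => Finsupp.single (0, 0) 1
  | N + 1 => if N % 2 = 0 then D1 n (mu1 m n N) else D0 m (mu1 m n N)

/-- A telescoping antidifference evaluates a signed sum. -/
theorem signedSum_eq_sub {M : Type*} [AddCommGroup M] {c F : ℤ → M}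
    (hF : ∀ i, F (i + 1) - F i = c i) (k : ℤ) : signedSum c k = F (k + 1) - F 0 := by
  have hpos : ∀ l : ℕ, ∑ i ∈ Finset.range l, c i = F l - F 0 := fun l ↦ by
    induction l with
    | zero => simp
    | succ l ih => rw [Finset.sum_range_succ, ih, ← hF]; push_cast; abel
  have hneg : ∀ l : ℕ, ∑ i ∈ Finset.range l, c (-((i : ℤ) + 1)) = F 0 - F (-l) := fun l ↦ by
    induction l with
    | zero => simp
    | succ l ih =>
      rw [Finset.sum_range_succ, ih, ← hF]
      have h : -((l : ℤ) + 1) + 1 = -l := by ring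
      rw [h]; push_cast; abel
  rw [signedSum, hpos, hneg]
  rcases le_total 0 (k + 1) with h | h
  · rw [Int.toNat_of_nonneg h, Int.toNat_of_nonpos (by omega : -(k + 1) ≤ 0)]; simp
  · rw [Int.toNat_of_nonneg (by omega : 0 ≤ -(k + 1)), Int.toNat_of_nonpos h]; simp

theorem map_signedSum {M M' : Type*} [AddCommGroup M] [AddCommGroup M'] (φ : M →+ M')
    (c : ℤ → M) (k : ℤ) : φ (signedSum c k) = signedSum (fun i ↦ φ (c i)) k := by
  simp [signedSum]

/-- Integration of a rational-valued function against a finitely supported `ν`. -/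
def integral (f : ℤ × ℤ → ℚ) : (ℤ × ℤ →₀ ℤ) →+ ℚ :=
  Finsupp.liftAddHom fun p ↦ (AddMonoidHom.mulRight (f p)).comp (Int.castAddHom ℚ)

theorem integral_apply (f : ℤ × ℤ → ℚ) (ν : ℤ × ℤ →₀ ℤ) :
    integral f ν = ν.sum fun p c ↦ (c : ℚ) * f p := rfl

theorem integral_single (f : ℤ × ℤ → ℚ) (p : ℤ × ℤ) (c : ℤ) :
    integral f (Finsupp.single p c) = c * f p := by
  simp [integral_apply]

theorem integral_add (f g : ℤ × ℤ → ℚ) (ν : ℤ × ℤ →₀ ℤ) :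
    integral (fun p ↦ f p + g p) ν = integral f ν + integral g ν := by
  simp [integral_apply, mul_add, Finsupp.sum_add]

theorem integral_const_mul (r : ℚ) (f : ℤ × ℤ → ℚ) (ν : ℤ × ℤ →₀ ℤ) :
    integral (fun p ↦ r * f p) ν = r * integral f ν := by
  simp [integral_apply, Finsupp.mul_sum, mul_left_comm]

theorem cast_mass (ν : ℤ × ℤ →₀ ℤ) : (mass ν : ℚ) = integral (fun _ ↦ 1) ν := by
  simp [mass, integral_apply, Finsupp.sum]

theorem expVal_eq (ν : ℤ × ℤ →₀ ℤ) (f : ℤ × ℤ → ℚ) :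
    expVal ν f = (integral (fun _ ↦ 1) ν)⁻¹ * integral f ν := by
  rw [expVal, cast_mass, integral_apply f]

theorem integral_D0 (m : ℕ) (f : ℤ × ℤ → ℚ) (ν : ℤ × ℤ →₀ ℤ) :
    integral f (D0 m ν) = integral
      (fun p ↦ signedSum (fun i ↦ f (p.1 + i, p.2)) ((m : ℤ) - 2 * (p.1 - p.2))) ν := by
  rw [D0, map_finsuppSum, integral_apply _ ν]
  simp [map_signedSum, integral_single]

theorem integral_D1 (n : ℕ) (f : ℤ × ℤ → ℚ) (ν : ℤ × ℤ →₀ ℤ) :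
    integral f (D1 n ν) = integral
      (fun p ↦ signedSum (fun i ↦ f (p.1, p.2 + i)) ((n : ℤ) + 2 * (p.1 - p.2))) ν := by
  rw [D1, map_finsuppSum, integral_apply _ ν]
  simp [map_signedSum, integral_single]

/-- The finite-weight coordinate `a - b`, centred at `c`. -/
def centred (c : ℚ) (p : ℤ × ℤ) : ℚ := p.1 - p.2 - c

/-- The low-order moments of `ν`, with `a - b` centred at `c`: total mass `M`, second moment `S`,
vanishing first and third moments, degree moment `A` and mixed moment `U`. -/
structure HasMoments (ν : ℤ × ℤ →₀ ℤ) (c M S A U : ℚ) : Prop where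
  mass : integral (fun _ ↦ 1) ν = M
  first : integral (centred c) ν = 0
  second : integral (fun p ↦ centred c p ^ 2) ν = S
  third : integral (fun p ↦ centred c p ^ 3) ν = 0
  degree : integral fa ν = A
  mixed : integral (fun p ↦ centred c p * fa p) ν = U

theorem hasMoments_single : HasMoments (Finsupp.single (0, 0) 1) 0 1 0 0 0 := by
  constructor <;> simp [integral_single, centred, fa]

namespace HasMoments

variable {ν : ℤ × ℤ →₀ ℤ} {c M S A U : ℚ}

/-- Integration of a polynomial in the moments tracked by `HasMoments`. -/
theorem integral_eq (h : HasMoments ν c M S A U) {f : ℤ × ℤ → ℚ} (r₀ r₁ r₂ r₃ s t : ℚ)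
    (hf : ∀ p, f p = r₀ * 1 + r₁ * centred c p + r₂ * centred c p ^ 2 + r₃ * centred c p ^ 3 +
      s * fa p + t * (centred c p * fa p)) :
    integral f ν = r₀ * M + r₂ * S + s * A + t * U := by
  rw [funext hf]
  simp only [integral_add, integral_const_mul]
  rw [h.mass, h.first, h.second, h.third, h.degree, h.mixed]
  ring

theorem apply_D0 (h : HasMoments ν c M S A U) (m : ℕ) {K : ℚ} (hK : K = m + 1 - 2 * c) :
    HasMoments (D0 m ν) (m / 2) (K * M) (K * S + (K ^ 3 - K) / 12 * M)
      (K * A + K * (K - 1) / 2 * M + 2 * S - 2 * U) (K * S + (K ^ 3 - K) / 12 * M) := by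
  subst hK
  constructor <;> rw [integral_D0]
  · rw [h.integral_eq (m + 1 - 2 * c) (-2) 0 0 0 0 fun p ↦ ?_]
    · ring
    rw [signedSum_eq_sub (F := fun i ↦ (i : ℚ)) fun i ↦ by push_cast; ring]
    simp only [centred]; push_cast; ring
  · rw [h.integral_eq 0 0 0 0 0 0 fun p ↦ ?_]
    · ring
    rw [signedSum_eq_sub (F := fun i ↦ (p.1 - p.2 - m / 2 + i : ℚ) *
      (p.1 - p.2 - m / 2 + i - 1) / 2) fun i ↦ by simp only [centred]; push_cast; ring]
    push_cast; ring
  · rw [h.integral_eq (((m + 1 - 2 * c) ^ 3 - (m + 1 - 2 * c)) / 12)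
      ((1 - 3 * (m + 1 - 2 * c) ^ 2) / 6) (m + 1 - 2 * c) (-2 / 3) 0 0 fun p ↦ ?_]
    · ring
    rw [signedSum_eq_sub (F := fun i ↦ (p.1 - p.2 - m / 2 + i : ℚ) * (p.1 - p.2 - m / 2 + i - 1) *
      (2 * (p.1 - p.2 - m / 2 + i) - 1) / 6) fun i ↦ by simp only [centred]; push_cast; ring]
    simp only [centred]; push_cast; ring
  · rw [h.integral_eq 0 0 0 0 0 0 fun p ↦ ?_]
    · ring
    rw [signedSum_eq_sub (F := fun i ↦ ((p.1 - p.2 - m / 2 + i : ℚ) *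
      (p.1 - p.2 - m / 2 + i - 1) / 2) ^ 2) fun i ↦ by simp only [centred]; push_cast; ring]
    push_cast; ring
  · rw [h.integral_eq ((m + 1 - 2 * c) * (m - 2 * c) / 2) (1 - 2 * (m + 1 - 2 * c)) 2 0
      (m + 1 - 2 * c) (-2) fun p ↦ ?_]
    · ring
    rw [signedSum_eq_sub (F := fun i ↦ (p.1 * i + i * (i - 1) / 2 : ℚ)) fun i ↦ by
      simp only [fa]; push_cast; ring]
    simp only [centred, fa]; push_cast; ring
  · rw [h.integral_eq (((m + 1 - 2 * c) ^ 3 - (m + 1 - 2 * c)) / 12)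
      ((1 - 3 * (m + 1 - 2 * c) ^ 2) / 6) (m + 1 - 2 * c) (-2 / 3) 0 0 fun p ↦ ?_]
    · ring
    rw [signedSum_eq_sub (F := fun i ↦ (p.1 - p.2 - m / 2 + i : ℚ) * (p.1 - p.2 - m / 2 + i - 1) *
      (2 * (p.1 - p.2 - m / 2 + i) - 1) / 6 + (p.2 + m / 2) * ((p.1 - p.2 - m / 2 + i : ℚ) *
      (p.1 - p.2 - m / 2 + i - 1) / 2)) fun i ↦ by simp only [centred, fa]; push_cast; ring]
    simp only [centred, fa]; push_cast; ring

theorem apply_D1 (h : HasMoments ν c M S A U) (n : ℕ) {K : ℚ} (hK : K = n + 1 + 2 * c) :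
    HasMoments (D1 n ν) (-n / 2) (K * M) (K * S + (K ^ 3 - K) / 12 * M) (K * A + 2 * U) 0 := by
  subst hK
  constructor <;> rw [integral_D1]
  · rw [h.integral_eq (n + 1 + 2 * c) 2 0 0 0 0 fun p ↦ ?_]
    · ring
    rw [signedSum_eq_sub (F := fun i ↦ (i : ℚ)) fun i ↦ by push_cast; ring]
    simp only [centred]; push_cast; ring
  · rw [h.integral_eq 0 0 0 0 0 0 fun p ↦ ?_]
    · ring
    rw [signedSum_eq_sub (F := fun i ↦ -((p.2 - p.1 - n / 2 + i : ℚ) *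
      (p.2 - p.1 - n / 2 + i - 1) / 2)) fun i ↦ by simp only [centred]; push_cast; ring]
    push_cast; ring
  · rw [h.integral_eq (((n + 1 + 2 * c) ^ 3 - (n + 1 + 2 * c)) / 12)
      ((3 * (n + 1 + 2 * c) ^ 2 - 1) / 6) (n + 1 + 2 * c) (2 / 3) 0 0 fun p ↦ ?_]
    · ring
    rw [signedSum_eq_sub (F := fun i ↦ (p.2 - p.1 - n / 2 + i : ℚ) * (p.2 - p.1 - n / 2 + i - 1) *
      (2 * (p.2 - p.1 - n / 2 + i) - 1) / 6) fun i ↦ by simp only [centred]; push_cast; ring]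
    simp only [centred]; push_cast; ring
  · rw [h.integral_eq 0 0 0 0 0 0 fun p ↦ ?_]
    · ring
    rw [signedSum_eq_sub (F := fun i ↦ -((p.2 - p.1 - n / 2 + i : ℚ) *
      (p.2 - p.1 - n / 2 + i - 1) / 2) ^ 2) fun i ↦ by simp only [centred]; push_cast; ring]
    push_cast; ring
  · rw [h.integral_eq 0 0 0 0 (n + 1 + 2 * c) 2 fun p ↦ ?_]
    · ring
    rw [signedSum_eq_sub (F := fun i ↦ (p.1 * i : ℚ)) fun i ↦ by
      simp only [fa]; push_cast; ring]
    simp only [centred, fa]; push_cast; ring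
  · rw [h.integral_eq 0 0 0 0 0 0 fun p ↦ ?_]
    · ring
    rw [signedSum_eq_sub (F := fun i ↦ -(p.1 * ((p.2 - p.1 - n / 2 + i : ℚ) *
      (p.2 - p.1 - n / 2 + i - 1) / 2))) fun i ↦ by simp only [centred, fa]; push_cast; ring]
    push_cast; ring

theorem expVal_fa (h : HasMoments ν c M S A U) : expVal ν fa = M⁻¹ * A := by
  rw [expVal_eq, h.mass, h.degree]

end HasMoments

/-- The moments of `μ_{2j+1,0}`. -/
theorem exists_hasMoments_mu0_odd (m n j : ℕ) {K : ℚ} (hK : K = m + n + 1) :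
    ∃ M : ℚ, M ≠ 0 ∧ HasMoments (mu0 m n (2 * j + 1)) (m / 2) M
      (M * (m * (m + 2) + 2 * j * (K ^ 2 - 1)) / 12)
      (M * ((2 * (2 * j) * m * (m + 2) + 2 * j * (2 * j - 1) * (K ^ 2 - 1)) / (12 * K) +
        j * (K - 1) / 2 + m / 2))
      (M * (m * (m + 2) + 2 * j * (K ^ 2 - 1)) / 12) := by
  have hK0 : K ≠ 0 := by rw [hK]; positivity
  induction j with
  | zero =>
    refine ⟨m + 1, by positivity, ?_⟩
    have h := hasMoments_single.apply_D0 m rfl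
    have hmu : mu0 m n (2 * 0 + 1) = D0 m (Finsupp.single (0, 0) 1) := by simp [mu0]
    rw [hmu]
    convert h using 1 <;> push_cast <;> ring
  | succ j ih =>
    obtain ⟨M, hM, h⟩ := ih
    refine ⟨K * (K * M), by positivity, ?_⟩
    have h' := (h.apply_D1 n (K := K) (by rw [hK]; ring)).apply_D0 m (K := K) (by rw [hK]; ring)
    have hmu : mu0 m n (2 * (j + 1) + 1) = D0 m (D1 n (mu0 m n (2 * j + 1))) := by
      rw [show 2 * (j + 1) + 1 = 2 * j + 1 + 1 + 1 by ring, mu0, if_pos (by omega), mu0,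
        if_neg (by omega)]
    rw [hmu]
    convert h' using 1 <;> push_cast <;> field_simp <;> ring

/-- main theorem, expected degree, first case. -/
theorem stmt_15 (m n : ℕ) (N : ℕ) (hN : 1 ≤ N) :
    expVal (mu0 m n N) fa =
      (2 * ((N : ℚ) - 1) * (m : ℚ) * ((m : ℚ) + 2) +
        ((N : ℚ) - 1) * ((N : ℚ) - 2) * ((m : ℚ) + (n : ℚ)) * ((m : ℚ) + (n : ℚ) + 2)) /
        (12 * ((m : ℚ) + (n : ℚ) + 1)) +
      (((N - 1) / 2 : ℕ) : ℚ) * ((m : ℚ) + (n : ℚ)) / 2 + (m : ℚ) / 2 := by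
  have hK0 : (m : ℚ) + n + 1 ≠ 0 := by positivity
  obtain ⟨j, rfl | rfl⟩ : ∃ j, N = 2 * j + 1 ∨ N = 2 * j + 1 + 1 := ⟨(N - 1) / 2, by omega⟩
  · obtain ⟨M, hM, h⟩ := exists_hasMoments_mu0_odd m n j rfl
    rw [h.expVal_fa, inv_mul_cancel_left₀ hM, show (2 * j + 1 - 1) / 2 = j by omega]
    push_cast
    field_simp
    ring
  · obtain ⟨M, hM, h⟩ := exists_hasMoments_mu0_odd m n j rfl
    have h' := h.apply_D1 n (K := m + n + 1) (by ring)
    rw [mu0, if_neg (by omega), h'.expVal_fa, show (2 * j + 1 + 1 - 1) / 2 = j by omega]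
    push_cast
    field_simp
    ring
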